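/- Let m be a positive integer or half-integer (2m ∈ ℕ) and ν an integer with 0 ≤ ν ≤ 2m. Let τ lie in the upper half-plane and z ∈ ℂ with m·z ∉ ℤ + ℤτ. Then (−1)^ν q^{−mν²} θ^{(−)}_{ν+1/2, m+1/2}(τ, 0) · Φ₁^{[m,0]}(τ, z/2 + ντ, z/2 − ντ) + ∑_{r=0}^{2m−1} (∑_{j,p∈ℤ, 0<p≤j} − ∑_{j,p∈ℤ, j<p≤0}) (−1)^j q^{(m+1/2)(j+ν−(ν+1/2)/(2m+1))² − m(p+ν−r/(2m))²} θ_{r,m}(τ, z) = −(−1)^ν η(τ)³ · θ^{(−)}_{ν+1/2, m+1/2}(τ, z) / θ^{(−)}_{1/2, 1/2}(τ, z). -/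

import Mathlib

noncomputable section

open Complex

/-- `e2 w = exp (2 π i w)`; with `q = e^{2πiτ}`, the power `q^x` corresponds to `e2 (x * τ)`. -/
def e2 (w : ℂ) : ℂ := Complex.exp (2 * (Real.pi : ℂ) * Complex.I * w)

/-- Jacobi-type theta function `θ^{(ε)}_{n,m}(τ, z) = ∑_{j∈ℤ} ε^j q^{m(j+n/(2m))²} e^{2πim(j+n/(2m))z}`. -/
def jtheta (ε n m τ z : ℂ) : ℂ :=
  ∑' j : ℤ, ε ^ j *
    e2 (m * ((j : ℂ) + n / (2 * m)) ^ 2 * τ + m * ((j : ℂ) + n / (2 * m)) * z)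

/-- Mock theta function `Φ₁^{(ε)[m,s]}(τ, z₁, z₂)`. -/
def Phi1 (ε m s τ z₁ z₂ : ℂ) : ℂ :=
  ∑' j : ℤ, ε ^ j *
    e2 (m * (j : ℂ) * (z₁ + z₂) + s * z₁ + (m * (j : ℂ) ^ 2 + s * (j : ℂ)) * τ) /
      (1 - e2 (z₁ + (j : ℂ) * τ))

/-- Dedekind eta function `η(τ) = q^{1/24} ∏_{k≥1} (1 - q^k)`. -/
def dedekindEta (τ : ℂ) : ℂ := e2 (τ / 24) * ∏' k : ℕ, (1 - e2 (((k : ℂ) + 1) * τ))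

/-- Jacobi theta `ϑ₁₁(τ, z) = i ∑_{j∈ℤ} (−1)^j q^{(j+1/2)²/2} e^{2πi(j+1/2)z}`. -/
def theta11 (τ z : ℂ) : ℂ :=
  Complex.I * ∑' j : ℤ, (-1 : ℂ) ^ j *
    e2 (((j : ℂ) + 1 / 2) ^ 2 / 2 * τ + ((j : ℂ) + 1 / 2) * z)

/-- Indefinite double sum `(∑_{j,p∈ℤ, 0<p≤j} − ∑_{j,p∈ℤ, j<p≤0}) f j p`. -/
def indefSum (f : ℤ → ℤ → ℂ) : ℂ :=
  ∑' jp : ℤ × ℤ,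
    ((if 0 < jp.2 ∧ jp.2 ≤ jp.1 then f jp.1 jp.2 else 0) -
      (if jp.1 < jp.2 ∧ jp.2 ≤ 0 then f jp.1 jp.2 else 0))

/-- `g^{[m]}_{n,ν}(τ)`. -/
def gfun (m : ℂ) (n ν : ℤ) (τ : ℂ) : ℂ :=
  indefSum fun j p =>
    (-1 : ℂ) ^ j *
      e2 (((m + 1 / 2) * ((j : ℂ) + (ν : ℂ) - ((ν : ℂ) + 1 / 2) / (2 * m + 1)) ^ 2 -
        m * ((p : ℂ) + (ν : ℂ) - (n : ℂ) / (2 * m)) ^ 2) * τ)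

/-- `h^{[m]}_{n,ν}(τ, z)`. -/
def hfun (m : ℂ) (n ν : ℤ) (τ z : ℂ) : ℂ :=
  ∑' j : ℤ,
    e2 (m * (j : ℂ) * z + (n : ℂ) * z / 2 +
        (m * (j : ℂ) ^ 2 + (n : ℂ) * ((j : ℂ) + (ν : ℂ))) * τ) /
      (1 - e2 (m * z + 2 * m * ((j : ℂ) + (ν : ℂ)) * τ))

/-- `G^{[m]}_{n,ν}(τ, z)`. -/
def Gfun (m : ℂ) (n ν : ℤ) (τ z : ℂ) : ℂ :=
  gfun m n ν τ * jtheta 1 (n : ℂ) m τ z +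
    (-1 : ℂ) ^ ν * e2 (-(m * (ν : ℂ) ^ 2) * τ) *
      jtheta (-1) ((ν : ℂ) + 1 / 2) (m + 1 / 2) τ 0 * hfun m n ν τ z

/-- `F^{[m](a,b)}_{n,ν}(τ, z)`. -/
def Ffun (m : ℂ) (a b n ν : ℤ) (τ z : ℂ) : ℂ :=
  e2 ((a : ℂ) * z / 2 + (a : ℂ) ^ 2 / (4 * m) * τ) *
    Gfun m n ν τ (z + (a : ℂ) * τ / m + (b : ℂ) / m)

/-- The coefficient `f_{j,k}` of Lemma 3.1:
`f_{j,k} = (−1)^j q^{(m+1/2)(j+s/(2m+1))² − k²/(4m)} e^{−2πijm(z₁−z₂)+πik(z₁−z₂)}`. -/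
def fcoef (m s τ z₁ z₂ : ℂ) (j k : ℤ) : ℂ :=
  (-1 : ℂ) ^ j *
    e2 (((m + 1 / 2) * ((j : ℂ) + s / (2 * m + 1)) ^ 2 - (k : ℂ) ^ 2 / (4 * m)) * τ +
      (-((j : ℂ) * m) + (k : ℂ) / 2) * (z₁ - z₂))


section Part1

lemma e2_add (a b : ℂ) : e2 (a + b) = e2 a * e2 b := by
  simp only [e2, ← Complex.exp_add]; congr 1; ring

lemma e2_ne (a : ℂ) : e2 a ≠ 0 := Complex.exp_ne_zero _

lemma e2_zero : e2 0 = 1 := by simp [e2]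

lemma e2_pow (a : ℂ) (n : ℕ) : e2 a ^ n = e2 (n * a) := by
  simp only [e2, ← Complex.exp_nat_mul]; congr 1; ring

lemma e2_zpow (a : ℂ) (n : ℤ) : e2 a ^ n = e2 (n * a) := by
  simp only [e2, ← Complex.exp_int_mul]; congr 1; ring

lemma e2_neg (a : ℂ) : e2 (-a) = (e2 a)⁻¹ := by
  simp only [e2, ← Complex.exp_neg]; congr 1; ring

lemma e2_eq_one {a : ℂ} (h : e2 a = 1) : ∃ n : ℤ, a = n := by
  rw [e2, Complex.exp_eq_one_iff] at h
  obtain ⟨n, hn⟩ := h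
  refine ⟨n, ?_⟩
  have : (2 * (Real.pi : ℂ) * Complex.I) ≠ 0 := Complex.two_pi_I_ne_zero
  apply mul_left_cancel₀ this
  rw [hn]; ring

lemma e2_norm (a : ℂ) : ‖e2 a‖ = Real.exp (-(2 * Real.pi * a.im)) := by
  rw [e2, Complex.norm_exp]; congr 1
  simp

lemma e2_norm_lt (τ : ℂ) (hτ : 0 < τ.im) : ‖e2 τ‖ < 1 := by
  rw [e2_norm]; simp; positivity

lemma one_sub_q_ne (τ : ℂ) (hτ : 0 < τ.im) (k : ℕ) : 1 - e2 (((k : ℂ) + 1) * τ) ≠ 0 := by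
  intro h
  have h1 : e2 (((k : ℂ) + 1) * τ) = 1 := (sub_eq_zero.1 h).symm
  have h2 := e2_norm (((k : ℂ) + 1) * τ)
  rw [h1] at h2
  have h3 : ((k : ℝ) + 1) * τ.im = 0 := by
    have h4 : (((k : ℂ) + 1) * τ).im = ((k : ℝ) + 1) * τ.im := by simp
    rw [← h4]
    have hp := Real.pi_pos
    have : 2 * Real.pi ≠ 0 := by positivity
    rw [norm_one] at h2
    have h5 : 2 * Real.pi * (((k : ℂ) + 1) * τ).im = 0 :=
      neg_eq_zero.1 ((Real.exp_eq_one_iff _).1 h2.symm)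
    exact (mul_eq_zero.1 h5).resolve_left this
  have : 0 < ((k : ℝ) + 1) * τ.im := by positivity
  linarith

/-- finite q-Pochhammer `(q)_N`. -/
def qp (τ : ℂ) (N : ℕ) : ℂ := ∏ i ∈ Finset.range N, (1 - e2 (((i : ℂ) + 1) * τ))

lemma qp_ne (τ : ℂ) (hτ : 0 < τ.im) (N : ℕ) : qp τ N ≠ 0 :=
  Finset.prod_ne_zero_iff.2 fun i _ => one_sub_q_ne τ hτ i

lemma qp_succ (τ : ℂ) (N : ℕ) : qp τ (N + 1) = qp τ N * (1 - e2 (((N : ℂ) + 1) * τ)) := by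
  simp [qp, Finset.prod_range_succ]

/-- Gaussian binomial. -/
def qG (τ : ℂ) (N k : ℕ) : ℂ := if k ≤ N then qp τ N / (qp τ k * qp τ (N - k)) else 0

lemma qG_zero (τ : ℂ) (hτ : 0 < τ.im) (N : ℕ) : qG τ N 0 = 1 := by
  have := qp_ne τ hτ N
  have h0 : qp τ 0 = 1 := by simp [qp]
  rw [qG, if_pos (Nat.zero_le _), h0, Nat.sub_zero, one_mul, div_self this]

lemma qG_gt (τ : ℂ) (N k : ℕ) (h : N < k) : qG τ N k = 0 := by
  simp [qG, h]

lemma qG_pascal (τ : ℂ) (hτ : 0 < τ.im) (N k : ℕ) (hk : k ≤ N) :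
    qG τ (N + 1) (k + 1) = qG τ N (k + 1) + e2 (((N : ℂ) - k) * τ) * qG τ N k := by
  have h0 := qp_ne τ hτ
  obtain ⟨d, rfl⟩ := Nat.exists_eq_add_of_le hk
  rcases d with _ | d
  · have h1 := h0 k
    have h2 := h0 (k + 1)
    simp [qG, qp] at *
    simp [e2_zero]
    rw [div_self, div_self] <;> assumption
  · have h1 := h0 k
    have h2 := h0 d
    have h3 := one_sub_q_ne τ hτ k
    have h4 := one_sub_q_ne τ hτ d
    have h5 := h0 (k + (d + 1))
    have e1 : k + (d + 1) + 1 - (k + 1) = d + 1 := by omega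
    have e2' : k + (d + 1) - (k + 1) = d := by omega
    have e3 : k + (d + 1) - k = d + 1 := by omega
    rw [qG, qG, qG, if_pos (by omega), if_pos (by omega), if_pos (by omega), e1, e2', e3,
      qp_succ τ (k + (d + 1)), qp_succ τ k, qp_succ τ d]
    have e4 : e2 ((((k + (d + 1) : ℕ) : ℂ) + 1) * τ)
        = e2 (((d : ℂ) + 1) * τ) * e2 (((k : ℂ) + 1) * τ) := by
      rw [← e2_add]; congr 1; push_cast; ring
    have e5 : e2 ((((k + (d + 1) : ℕ) : ℂ) - k) * τ) = e2 (((d : ℂ) + 1) * τ) := by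
      congr 1; push_cast; ring
    rw [e4, e5]
    generalize e2 (((d : ℂ) + 1) * τ) = u at *
    generalize e2 (((k : ℂ) + 1) * τ) = v at *
    field_simp
    ring

/-- `∏_{i<N} (1 - x q^i)`. -/
def qP (τ : ℂ) (N : ℕ) (x : ℂ) : ℂ := ∏ i ∈ Finset.range N, (1 - x * e2 ((i : ℂ) * τ))

lemma qP_succ (τ : ℂ) (N : ℕ) (x : ℂ) : qP τ (N + 1) x = qP τ N x * (1 - x * e2 ((N : ℂ) * τ)) := by
  simp [qP, Finset.prod_range_succ]

lemma qP_succ' (τ : ℂ) (N : ℕ) (x : ℂ) : qP τ (N + 1) x = (1 - x) * qP τ N (x * e2 τ) := by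
  simp only [qP, Finset.prod_range_succ']
  simp only [Nat.cast_zero, zero_mul, e2_zero, mul_one]
  rw [mul_comm]
  congr 1
  apply Finset.prod_congr rfl
  intro i _
  rw [mul_assoc, ← e2_add]
  congr 3
  push_cast; ring

/-- General Pascal-type splitting of sums. -/
lemma pascal_sum (τ : ℂ) (hτ : 0 < τ.im) (N : ℕ) (f : ℕ → ℂ) :
    ∑ k ∈ Finset.range (N + 2), f k * qG τ (N + 1) k =
      ∑ k ∈ Finset.range (N + 1), f k * qG τ N k +
      ∑ k ∈ Finset.range (N + 1), f (k + 1) * (e2 (((N : ℂ) - k) * τ) * qG τ N k) := by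
  rw [Finset.sum_range_succ' _ (N + 1)]
  have h : ∑ k ∈ Finset.range (N + 1), f k * qG τ N k
      = ∑ k ∈ Finset.range (N + 1), f (k + 1) * qG τ N (k + 1) + f 0 := by
    have h1 := Finset.sum_range_succ (fun k => f k * qG τ N k) (N + 1)
    have h2 := Finset.sum_range_succ' (fun k => f k * qG τ N k) (N + 1)
    rw [h1] at h2
    simpa [qG_gt τ N (N + 1) (by omega), qG_zero τ hτ] using h2
  rw [h, qG_zero τ hτ, Finset.sum_congr rfl (fun k hk => by
    rw [qG_pascal τ hτ N k (by simpa [Nat.lt_succ_iff] using hk), mul_add]),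
    Finset.sum_add_distrib]
  ring

lemma qbinom (τ : ℂ) (hτ : 0 < τ.im) (N : ℕ) (x : ℂ) :
    ∑ k ∈ Finset.range (N + 1), ((-1 : ℂ) ^ k * e2 ((k : ℂ) * (k - 1) / 2 * τ) * x ^ k) * qG τ N k
      = qP τ N x := by
  induction N with
  | zero => simp [qG_zero τ hτ, qP, e2_zero]
  | succ N ih =>
    rw [pascal_sum τ hτ, ih, qP_succ, mul_sub, mul_one, sub_eq_add_neg]
    congr 1
    rw [← ih, Finset.sum_mul, ← Finset.sum_neg_distrib]
    apply Finset.sum_congr rfl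
    intro k _
    have : e2 (((k + 1 : ℕ) : ℂ) * ((k + 1 : ℕ) - 1) / 2 * τ) * e2 (((N : ℂ) - k) * τ)
        = e2 ((k : ℂ) * (k - 1) / 2 * τ) * e2 ((N : ℂ) * τ) := by
      rw [← e2_add, ← e2_add]; congr 1; push_cast; ring
    linear_combination (-1 : ℂ) ^ (k + 1) * x ^ (k + 1) * qG τ N k * this

lemma qpf0 (τ : ℂ) (hτ : 0 < τ.im) (N : ℕ) (x : ℂ) (hx : ∀ k : ℕ, 1 - x * e2 ((k : ℂ) * τ) ≠ 0) :
    ∑ k ∈ Finset.range (N + 1), ((-1 : ℂ) ^ k * e2 ((k : ℂ) * (k + 1) / 2 * τ) /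
      (1 - x * e2 ((k : ℂ) * τ))) * qG τ N k = qp τ N / qP τ (N + 1) x := by
  induction N generalizing x with
  | zero => simp [qG_zero τ hτ, qP, qp, e2_zero]
  | succ N ih =>
    have hx' : ∀ k : ℕ, 1 - (x * e2 τ) * e2 ((k : ℂ) * τ) ≠ 0 := by
      intro k
      have := hx (k + 1)
      rwa [show ((k + 1 : ℕ) : ℂ) * τ = τ + k * τ by push_cast; ring, e2_add, ← mul_assoc] at this
    have h2 : ∑ k ∈ Finset.range (N + 1), ((-1 : ℂ) ^ (k + 1) *
        e2 (((k + 1 : ℕ) : ℂ) * ((k + 1 : ℕ) + 1) / 2 * τ) /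
      (1 - x * e2 (((k + 1 : ℕ) : ℂ) * τ))) * (e2 (((N : ℂ) - k) * τ) * qG τ N k)
       = - e2 (((N : ℂ) + 1) * τ) * (qp τ N / qP τ (N + 1) (x * e2 τ)) := by
      rw [← ih _ hx', Finset.mul_sum]
      apply Finset.sum_congr rfl
      intro k _
      rw [show ((k + 1 : ℕ) : ℂ) * τ = τ + k * τ by push_cast; ring, e2_add, ← mul_assoc x]
      have : e2 (((k + 1 : ℕ) : ℂ) * ((k + 1 : ℕ) + 1) / 2 * τ) * e2 (((N : ℂ) - k) * τ)
        = e2 ((k : ℂ) * (k + 1) / 2 * τ) * e2 (((N : ℂ) + 1) * τ) := by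
        rw [← e2_add, ← e2_add]; congr 1; push_cast; ring
      linear_combination (-1 : ℂ) ^ (k + 1) / (1 - x * e2 τ * e2 (k * τ)) * qG τ N k * this
    rw [pascal_sum τ hτ, ih x hx, h2]
    have hP : qP τ N (x * e2 τ) ≠ 0 := Finset.prod_ne_zero_iff.2 fun i _ => hx' i
    have h0 : 1 - x ≠ 0 := by simpa [e2_zero] using hx 0
    have hN := hx (N + 1)
    rw [qP_succ' τ N x, qP_succ' τ (N + 1) x, qP_succ τ N (x * e2 τ), qp_succ,
      mul_assoc x, ← e2_add, show τ + N * τ = ((N : ℂ) + 1) * τ by ring]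
    push_cast at hN
    field_simp
    ring

lemma qP_zero_at (τ : ℂ) (N s : ℕ) (h : s < N) : qP τ N (e2 (-(s : ℂ) * τ)) = 0 := by
  apply Finset.prod_eq_zero (Finset.mem_range.2 h)
  rw [← e2_add, show -(s : ℂ) * τ + s * τ = 0 by ring, e2_zero, sub_self]

lemma qpf (τ : ℂ) (hτ : 0 < τ.im) (N s : ℕ) (hs : s ≤ N) (x : ℂ)
    (hx : ∀ k : ℕ, 1 - x * e2 ((k : ℂ) * τ) ≠ 0) :
    ∑ k ∈ Finset.range (N + 1), ((-1 : ℂ) ^ k * e2 (((k : ℂ) * (k + 1) / 2 - s * k) * τ) /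
      (1 - x * e2 ((k : ℂ) * τ))) * qG τ N k = x ^ s * (qp τ N / qP τ (N + 1) x) := by
  induction s with
  | zero => simpa using qpf0 τ hτ N x hx
  | succ s ih =>
    rw [pow_succ, mul_comm (x ^ s) x, mul_assoc, ← ih (by omega)]
    have h0 := qbinom τ hτ N (e2 (-(s : ℂ) * τ))
    rw [qP_zero_at τ N s (by omega)] at h0
    rw [← sub_zero (x * _), ← neg_zero, ← h0, Finset.mul_sum, sub_neg_eq_add,
      ← Finset.sum_add_distrib]
    apply Finset.sum_congr rfl
    intro k _
    have hk := hx k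
    have a1 : e2 (((k : ℂ) * (k + 1) / 2 - s * k) * τ)
        = e2 (((k : ℂ) * (k + 1) / 2 - (s + 1 : ℕ) * k) * τ) * e2 ((k : ℂ) * τ) := by
      rw [← e2_add]; congr 1; push_cast; ring
    have a2 : e2 ((k : ℂ) * (k - 1) / 2 * τ) * e2 (-(s : ℂ) * τ) ^ k
        = e2 (((k : ℂ) * (k + 1) / 2 - (s + 1 : ℕ) * k) * τ) := by
      rw [e2_pow, ← e2_add]; congr 1; push_cast; ring
    rw [mul_assoc ((-1 : ℂ) ^ k), a2, a1]
    field_simp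
    ring

end Part1

section Part2
open Filter Topology

lemma summable_exp_neg_abs : Summable fun n : ℤ => Real.exp (-|(n : ℝ)|) := by
  apply Summable.of_nat_of_neg
  · simpa using Real.summable_exp_neg_nat
  · simpa using Real.summable_exp_neg_nat

lemma quad_bound (ε b x : ℝ) (hε : 0 < ε) : -(ε * x ^ 2) + b * |x| ≤ (b + 1) ^ 2 / (4 * ε) - |x| := by
  have h : 0 ≤ (2 * ε * |x| - (b + 1)) ^ 2 / (4 * ε) := by positivity
  have h2 : (2 * ε * |x| - (b + 1)) ^ 2 / (4 * ε) = ε * |x| ^ 2 - (b + 1) * |x| + (b + 1) ^ 2 / (4 * ε) := by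
    field_simp; ring
  rw [h2, sq_abs] at h
  linarith

lemma gauss_summable (A B C : ℂ) (hA : 0 < A.im) :
    Summable fun n : ℤ => ‖e2 (A * (n : ℂ) ^ 2 + B * n + C)‖ := by
  have hp := Real.pi_pos
  set ε := 2 * Real.pi * A.im with hε
  have hε0 : 0 < ε := by positivity
  set b := 2 * Real.pi * |B.im| with hb
  refine Summable.of_nonneg_of_le (fun _ => norm_nonneg _) (fun n => ?_)
    (summable_exp_neg_abs.mul_left (Real.exp ((b + 1) ^ 2 / (4 * ε) - 2 * Real.pi * C.im)))
  rw [e2_norm, ← Real.exp_add]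
  apply Real.exp_le_exp.2
  have h1 : (A * (n : ℂ) ^ 2 + B * n + C).im = A.im * n ^ 2 + B.im * n + C.im := by
    have : ((n : ℂ) ^ 2) = (((n : ℝ) ^ 2 : ℝ) : ℂ) := by push_cast; rfl
    rw [this]
    simp [Complex.add_im, Complex.mul_im, -ofReal_pow]
  rw [h1]
  have h2 := quad_bound ε b n hε0
  have h3 : -(B.im * n) ≤ |B.im| * |(n : ℝ)| := by rw [← abs_mul]; exact neg_le_abs _
  have h4 : 2 * Real.pi * (-(B.im * n)) ≤ 2 * Real.pi * (|B.im| * |(n : ℝ)|) :=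
    mul_le_mul_of_nonneg_left h3 (by positivity)
  rw [hb, hε] at *
  linarith

lemma pm_norm (j : ℤ) : ‖(-1 : ℂ) ^ j‖ = 1 := by simp

lemma qp_tendsto (τ : ℂ) (hτ : 0 < τ.im) :
    Tendsto (qp τ) atTop (𝓝 (∏' k : ℕ, (1 - e2 (((k : ℂ) + 1) * τ)))) := by
  have h := (ModularForm.multipliable_one_sub_pow (e2_norm_lt τ hτ)).tendsto_prod_tprod_nat
  have h2 : ∀ k : ℕ, e2 τ ^ (k + 1) = e2 (((k : ℂ) + 1) * τ) := by
    intro k; rw [e2_pow]; push_cast; rfl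
  simp_rw [h2] at h
  exact h

lemma qp_inf_ne (τ : ℂ) (hτ : 0 < τ.im) : (∏' k : ℕ, (1 - e2 (((k : ℂ) + 1) * τ))) ≠ 0 := by
  have := ModularForm.eta_tprod_ne_zero (z := τ) hτ
  convert this using 5 with k
  rw [ModularForm.eta_q_eq_cexp, e2]; congr 1; ring

/-- centered Gaussian binomial -/
def qg (τ : ℂ) (n : ℕ) (j : ℤ) : ℂ := if -(n : ℤ) ≤ j then qG τ (2 * n) (n + j).toNat else 0

lemma tsum_qg (τ : ℂ) (n : ℕ) (f : ℤ → ℂ) :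
    ∑' j : ℤ, f j * qg τ n j = ∑ k ∈ Finset.range (2 * n + 1), f ((k : ℤ) - n) * qG τ (2 * n) k := by
  have hinj : Function.Injective (fun k : ℕ => (k : ℤ) - n) := by
    intro a b h; simpa using h
  rw [tsum_eq_sum (s := (Finset.range (2 * n + 1)).map ⟨_, hinj⟩), Finset.sum_map]
  · apply Finset.sum_congr rfl
    intro k _
    simp [qg]
  · intro j hj
    by_cases h1 : -(n : ℤ) ≤ j
    · have h2 : 2 * n < (n + j).toNat := by
        by_contra h3
        apply hj
        simp only [Finset.mem_map, Finset.mem_range, Function.Embedding.coeFn_mk]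
        exact ⟨(n + j).toNat, by omega, by omega⟩
      simp [qg, qG_gt τ _ _ h2]
    · simp [qg, h1]

lemma qp_lower (τ : ℂ) (hτ : 0 < τ.im) : ∃ c : ℝ, ∀ N, ‖(qp τ N)⁻¹‖ ≤ c := by
  have h := (qp_tendsto τ hτ).inv₀ (qp_inf_ne τ hτ)
  obtain ⟨c, hc⟩ := h.norm.bddAbove_range
  exact ⟨c, fun N => hc ⟨N, rfl⟩⟩

lemma qp_upper (τ : ℂ) (hτ : 0 < τ.im) : ∃ c : ℝ, ∀ N, ‖qp τ N‖ ≤ c := by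
  obtain ⟨c, hc⟩ := (qp_tendsto τ hτ).norm.bddAbove_range
  exact ⟨c, fun N => hc ⟨N, rfl⟩⟩

lemma qg_bound (τ : ℂ) (hτ : 0 < τ.im) : ∃ c : ℝ, ∀ n j, ‖qg τ n j‖ ≤ c := by
  obtain ⟨c, hc⟩ := qp_lower τ hτ
  obtain ⟨d, hd⟩ := qp_upper τ hτ
  have hc0 : 0 ≤ c := (norm_nonneg _).trans (hc 0)
  have hd0 : 0 ≤ d := (norm_nonneg _).trans (hd 0)
  refine ⟨d * (c * c), fun n j => ?_⟩
  rw [qg]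
  split_ifs
  · rw [qG]
    split_ifs
    · rw [div_eq_mul_inv, mul_inv, norm_mul, norm_mul]
      gcongr
      · exact hd _
      · exact hc _
      · exact hc _
    · simp; positivity
  · simp; positivity

lemma qg_tendsto (τ : ℂ) (hτ : 0 < τ.im) (j : ℤ) : Tendsto (fun n => qg τ n j) atTop
    (𝓝 (∏' k : ℕ, (1 - e2 (((k : ℂ) + 1) * τ)))⁻¹) := by
  have hE := qp_inf_ne τ hτ
  have hT := qp_tendsto τ hτ
  set E := ∏' k : ℕ, (1 - e2 (((k : ℂ) + 1) * τ))
  have t1 : Tendsto (fun n : ℕ => 2 * n) atTop atTop :=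
    tendsto_atTop_mono (fun n => by simp only [id]; omega) tendsto_id
  have t2 : Tendsto (fun n : ℕ => ((n : ℤ) + j).toNat) atTop atTop := by
    rw [tendsto_atTop]; intro b
    filter_upwards [eventually_ge_atTop (b + j.natAbs)] with n hn
    omega
  have t3 : Tendsto (fun n : ℕ => 2 * n - ((n : ℤ) + j).toNat) atTop atTop := by
    rw [tendsto_atTop]; intro b
    filter_upwards [eventually_ge_atTop (b + j.natAbs)] with n hn
    omega
  have h := (hT.comp t1).div ((hT.comp t2).mul (hT.comp t3)) (mul_ne_zero hE hE)
  have e : E / (E * E) = E⁻¹ := by field_simp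
  rw [e] at h
  refine h.congr' ?_
  filter_upwards [eventually_ge_atTop (j.natAbs)] with n hn
  simp only [qg, qG, Function.comp]
  rw [if_pos (by omega), if_pos (by omega)]
  rfl

lemma qg_lim (τ : ℂ) (hτ : 0 < τ.im) (f : ℤ → ℂ) (hf : Summable fun j => ‖f j‖) :
    Tendsto (fun n => ∑' j, f j * qg τ n j) atTop
      (𝓝 ((∑' j, f j) * (∏' k : ℕ, (1 - e2 (((k : ℂ) + 1) * τ)))⁻¹)) := by
  obtain ⟨c, hc⟩ := qg_bound τ hτ
  rw [← tsum_mul_right]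
  apply tendsto_tsum_of_dominated_convergence (hf.mul_right c)
  · intro j
    exact (qg_tendsto τ hτ j).const_mul _
  · refine Eventually.of_forall fun n j => ?_
    rw [norm_mul]
    gcongr
    exact hc n j

/-- boundedness of the denominators -/
lemma den_bound (τ : ℂ) (hτ : 0 < τ.im) (w : ℂ) :
    ∃ c : ℝ, ∀ n : ℤ, ‖(1 - e2 (w + n * τ))⁻¹‖ ≤ c := by
  have hq : ∀ n : ℤ, ‖e2 (w + n * τ)‖ = Real.exp (-(2 * Real.pi * w.im)) * Real.exp (-(2 * Real.pi * τ.im) * n) := by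
    intro n; rw [e2_norm, ← Real.exp_add]; congr 1; simp; ring
  have hp := Real.pi_pos
  have hk : 0 < 2 * Real.pi * τ.im := by positivity
  -- n → +∞
  have h1 : Tendsto (fun n : ℕ => (1 - e2 (w + (n : ℤ) * τ))⁻¹) atTop (𝓝 1) := by
    have : Tendsto (fun n : ℕ => e2 (w + (n : ℤ) * τ)) atTop (𝓝 0) := by
      rw [tendsto_zero_iff_norm_tendsto_zero]
      simp_rw [hq]
      rw [← mul_zero (Real.exp (-(2 * Real.pi * w.im)))]
      apply Tendsto.const_mul
      apply Real.tendsto_exp_atBot.comp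
      apply Tendsto.const_mul_atTop_of_neg (by linarith)
      simp only [Int.cast_natCast]
      exact tendsto_natCast_atTop_atTop
    have h3 := ((tendsto_const_nhds (x := (1 : ℂ))).sub this).inv₀ (by simp)
    simpa using h3
  have h2 : Tendsto (fun n : ℕ => (1 - e2 (w + (-(n : ℤ) : ℤ) * τ))⁻¹) atTop (𝓝 0) := by
    have : Tendsto (fun n : ℕ => ‖e2 (w + (-(n : ℤ) : ℤ) * τ)‖) atTop atTop := by
      simp_rw [hq]
      apply Tendsto.const_mul_atTop (Real.exp_pos _)
      apply Real.tendsto_exp_atTop.comp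
      have : Tendsto (fun n : ℕ => (2 * Real.pi * τ.im) * (n : ℝ)) atTop atTop :=
        Tendsto.const_mul_atTop hk tendsto_natCast_atTop_atTop
      refine this.congr fun n => ?_
      push_cast; ring
    rw [tendsto_zero_iff_norm_tendsto_zero]
    simp_rw [norm_inv]
    apply Tendsto.inv_tendsto_atTop
    apply tendsto_atTop_mono (f := fun n : ℕ => ‖e2 (w + (-(n : ℤ) : ℤ) * τ)‖ - 1)
    · intro n
      have := norm_sub_norm_le (e2 (w + (-(n : ℤ) : ℤ) * τ)) 1
      rw [norm_sub_rev, norm_one] at this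
      exact this
    · exact tendsto_atTop_add_const_right _ _ this
  obtain ⟨c1, hc1⟩ := h1.norm.bddAbove_range
  obtain ⟨c2, hc2⟩ := h2.norm.bddAbove_range
  refine ⟨max c1 c2, fun n => ?_⟩
  obtain ⟨k, rfl | rfl⟩ := n.eq_nat_or_neg
  · exact (hc1 ⟨k, rfl⟩).trans (le_max_left _ _)
  · exact (hc2 ⟨k, rfl⟩).trans (le_max_right _ _)

end Part2

section Part3
open Filter Topology

lemma TL (τ : ℂ) (hτ : 0 < τ.im) (w : ℂ) (hw : ∀ n : ℤ, 1 - e2 (w + n * τ) ≠ 0) :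
    (∑' j : ℤ, (-1 : ℂ) ^ j * e2 ((j : ℂ) * (j + 1) / 2 * τ + j * w)) *
      (∑' j : ℤ, (-1 : ℂ) ^ j * e2 ((j : ℂ) * (j + 1) / 2 * τ) / (1 - e2 (w + j * τ))) =
      - e2 (-w) * (∏' k : ℕ, (1 - e2 (((k : ℂ) + 1) * τ))) ^ 3 := by
  have hτ2 : 0 < (τ / 2).im := by
    have : (τ / 2).im = τ.im / 2 := by simp
    rw [this]; positivity
  have s1 : Summable fun j : ℤ => ‖(-1 : ℂ) ^ j * e2 ((j : ℂ) * (j + 1) / 2 * τ + j * w)‖ := by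
    refine (gauss_summable (τ / 2) (τ / 2 + w) 0 hτ2).congr fun j => ?_
    rw [norm_mul, pm_norm, one_mul]; congr 2; ring
  have s2 : Summable fun j : ℤ => ‖(-1 : ℂ) ^ j * e2 ((j : ℂ) * (j + 1) / 2 * τ) / (1 - e2 (w + j * τ))‖ := by
    obtain ⟨c, hc⟩ := den_bound τ hτ w
    refine Summable.of_nonneg_of_le (fun _ => norm_nonneg _) (fun j => ?_)
      ((gauss_summable (τ / 2) (τ / 2) 0 hτ2).mul_right c)
    rw [div_eq_mul_inv, norm_mul, norm_mul, pm_norm, one_mul]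
    refine mul_le_mul (le_of_eq ?_) (hc j) (norm_nonneg _) (norm_nonneg _)
    congr 2; ring
  have l1 := qg_lim τ hτ _ s1
  have l2 := qg_lim τ hτ _ s2
  have hE := qp_inf_ne τ hτ
  have hT := qp_tendsto τ hτ
  set E := ∏' k : ℕ, (1 - e2 (((k : ℂ) + 1) * τ))
  have t1 : Tendsto (fun n : ℕ => 2 * n) atTop atTop :=
    tendsto_atTop_mono (fun n => by simp only [id]; omega) tendsto_id
  have h0 : Tendsto (fun n : ℕ => e2 ((n : ℂ) * τ)) atTop (𝓝 0) := by
    have := tendsto_pow_atTop_nhds_zero_of_norm_lt_one (e2_norm_lt τ hτ)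
    refine this.congr fun n => e2_pow _ _
  have l3 : Tendsto (fun n : ℕ => qp τ (2 * n) / (e2 ((n : ℂ) * τ) - e2 w)) atTop
      (𝓝 (E / (0 - e2 w))) :=
    (hT.comp t1).div (h0.sub tendsto_const_nhds) (by simpa using e2_ne w)
  have key : ∀ n : ℕ, (∑' j : ℤ, (-1 : ℂ) ^ j * e2 ((j : ℂ) * (j + 1) / 2 * τ + j * w) * qg τ n j) *
      (∑' j : ℤ, (-1 : ℂ) ^ j * e2 ((j : ℂ) * (j + 1) / 2 * τ) / (1 - e2 (w + j * τ)) * qg τ n j)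
      = qp τ (2 * n) / (e2 ((n : ℂ) * τ) - e2 w) := by
    intro n
    have hsgn : ∀ k : ℕ, (-1 : ℂ) ^ ((k : ℤ) - n) = (-1) ^ n * (-1) ^ k := by
      intro k
      rw [zpow_sub₀ (by norm_num), zpow_natCast, zpow_natCast, div_eq_mul_inv, mul_comm]
      congr 1
      rw [← inv_pow]; norm_num
    have hx : ∀ k : ℕ, 1 - e2 (w - n * τ) * e2 ((k : ℂ) * τ) ≠ 0 := by
      intro k
      have := hw ((k : ℤ) - n)
      rw [← e2_add]; convert this using 3; push_cast; ring
    have a1 : (∑' j : ℤ, (-1 : ℂ) ^ j * e2 ((j : ℂ) * (j + 1) / 2 * τ + j * w) * qg τ n j)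
        = (-1) ^ n * e2 ((n : ℂ) * (n - 1) / 2 * τ - n * w) * qP τ (2 * n) (e2 (w - n * τ) * e2 τ) := by
      rw [tsum_qg, ← qbinom τ hτ, Finset.mul_sum]
      apply Finset.sum_congr rfl
      intro k _
      rw [hsgn]
      have : e2 ((((k : ℤ) - n : ℤ) : ℂ) * ((((k : ℤ) - n : ℤ) : ℂ) + 1) / 2 * τ + (((k : ℤ) - n : ℤ) : ℂ) * w)
        = e2 ((n : ℂ) * (n - 1) / 2 * τ - n * w) * (e2 ((k : ℂ) * (k - 1) / 2 * τ) * (e2 (w - n * τ) * e2 τ) ^ k) := by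
        rw [← e2_add, e2_pow, ← e2_add, ← e2_add]; congr 1; push_cast; ring
      rw [this]; ring
    have a2 : (∑' j : ℤ, (-1 : ℂ) ^ j * e2 ((j : ℂ) * (j + 1) / 2 * τ) / (1 - e2 (w + j * τ)) * qg τ n j)
        = (-1) ^ n * e2 ((n : ℂ) * (n - 1) / 2 * τ) * (e2 (w - n * τ) ^ n *
          (qp τ (2 * n) / qP τ (2 * n + 1) (e2 (w - n * τ)))) := by
      rw [tsum_qg, ← qpf τ hτ (2 * n) n (by omega) _ hx, Finset.mul_sum]
      apply Finset.sum_congr rfl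
      intro k _
      rw [hsgn]
      have : e2 ((((k : ℤ) - n : ℤ) : ℂ) * ((((k : ℤ) - n : ℤ) : ℂ) + 1) / 2 * τ)
        = e2 ((n : ℂ) * (n - 1) / 2 * τ) * e2 (((k : ℂ) * (k + 1) / 2 - n * k) * τ) := by
        rw [← e2_add]; congr 1; push_cast; ring
      have h2 : e2 (w + (((k : ℤ) - n : ℤ) : ℂ) * τ) = e2 (w - n * τ) * e2 ((k : ℂ) * τ) := by
        rw [← e2_add]; congr 1; push_cast; ring
      rw [this, h2]; ring
    have hP : qP τ (2 * n + 1) (e2 (w - n * τ)) ≠ 0 := Finset.prod_ne_zero_iff.2 fun i _ => hx i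
    rw [a1, a2]
    rw [qP_succ'] at hP ⊢
    obtain ⟨hP1, hP2⟩ := mul_ne_zero_iff.1 hP
    have b1 : e2 ((n : ℂ) * (n - 1) / 2 * τ - n * w) * e2 ((n : ℂ) * (n - 1) / 2 * τ) * e2 (w - n * τ) ^ n
       * e2 (n * τ) = 1 := by
      rw [e2_pow, ← e2_add, ← e2_add, ← e2_add]
      refine Eq.trans ?_ e2_zero
      congr 1; ring
    have b2 : e2 ((n : ℂ) * τ) - e2 w = e2 (n * τ) * (1 - e2 (w - n * τ)) := by
      rw [mul_sub, ← e2_add, mul_one]; congr 2; ring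
    have b3 : ((-1 : ℂ) ^ n) * (-1) ^ n = 1 := by rw [← mul_pow]; norm_num
    have hne := e2_ne ((n : ℂ) * τ)
    rw [b2]
    generalize e2 ((n : ℂ) * τ) = y at *
    generalize qP τ (2 * n) (e2 (w - n * τ) * e2 τ) = u at *
    generalize e2 (w - n * τ) = v at *
    rw [eq_div_iff (mul_ne_zero hne hP1)]
    generalize e2 ((n : ℂ) * (n - 1) / 2 * τ - n * w) = g1 at *
    generalize e2 ((n : ℂ) * (n - 1) / 2 * τ) = g2 at *
    have : (-1) ^ n * g1 * u * ((-1) ^ n * g2 * (v ^ n * (qp τ (2 * n) / ((1 - v) * u)))) * (y * (1 - v))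
      = ((-1) ^ n * (-1) ^ n) * (g1 * g2 * v ^ n * y) * qp τ (2 * n) * (((1 - v) * u) / ((1 - v) * u)) := by
      ring
    rw [this, b1, b3, div_self hP]; ring
  have l4 := l1.mul l2
  simp_rw [key] at l4
  have := tendsto_nhds_unique l4 l3
  rw [e2_neg]
  have hz := e2_ne w
  rw [zero_sub] at this
  generalize (∑' j : ℤ, (-1 : ℂ) ^ j * e2 ((j : ℂ) * (j + 1) / 2 * τ + j * w)) = S1 at *
  generalize (∑' j : ℤ, (-1 : ℂ) ^ j * e2 ((j : ℂ) * (j + 1) / 2 * τ) / (1 - e2 (w + j * τ))) = S2 at *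
  generalize e2 w = x at *
  field_simp at this ⊢
  linear_combination this

end Part3

section Part4
open Filter Topology

/-- the general term of the triple series -/
def trm (M : ℕ) (ν : ℤ) (τ z : ℂ) (n j k : ℤ) : ℂ :=
  (-1 : ℂ) ^ (n + j) *
    e2 (((n : ℂ) * (n + 1) / 2 + (((M : ℂ) + 1) * j + ν + 1 / 2) ^ 2 / (2 * ((M : ℂ) + 1)) +
      n * (k - ((M : ℂ) + 1) * j - ν - 1)) * τ + k * (z / 2))

/-- real exponent -/
def Er (M : ℕ) (ν : ℤ) (n j k : ℝ) : ℝ :=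
  n * (n + 1) / 2 + (((M : ℝ) + 1) * j + ν + 1 / 2) ^ 2 / (2 * ((M : ℝ) + 1)) +
      n * (k - ((M : ℝ) + 1) * j - ν - 1)

lemma Er_btw (M : ℕ) (ν : ℤ) (n j k a b L : ℝ) (ha : L ≤ Er M ν n j a) (hb : L ≤ Er M ν n j b)
    (h1 : a ≤ k) (h2 : k ≤ b) : L ≤ Er M ν n j k := by
  simp only [Er] at *
  rcases le_total 0 n with hn | hn
  · nlinarith [mul_nonneg hn (sub_nonneg.2 h1)]
  · nlinarith [mul_nonneg (neg_nonneg.2 hn) (sub_nonneg.2 h2)]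

lemma lin_bound (a x B : ℝ) (h : |a| ≤ B) : -(B * |x|) ≤ a * x := by
  have h1 : |a * x| ≤ B * |x| := by rw [abs_mul]; gcongr
  linarith [neg_abs_le (a * x)]

lemma Er_ends (M : ℕ) (hM : 0 < M) (ν : ℤ) : ∃ B : ℝ, ∀ n j : ℝ,
    (n ^ 2 + j ^ 2) / 8 - B * |n| - B * |j| ≤ Er M ν n j (M * j) ∧
    (n ^ 2 + j ^ 2) / 8 - B * |n| - B * |j| ≤ Er M ν n j (M * (n - ν)) ∧
    (n ^ 2 + j ^ 2) / 8 - B * |n| - B * |j| ≤ Er M ν n j ((M + 1) * j + ν + 1) := by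
  have hM1 : (1 : ℝ) ≤ M := by exact_mod_cast hM
  set c : ℝ := (ν : ℝ) + 1 / 2 with hc
  set α2 : ℝ := 1 / 2 - ν - 1 with h2
  set α3 : ℝ := 1 / 2 - M * ν - ν - 1 with h3
  refine ⟨1 / 2 + |α2| + |α3| + |c|, fun n j => ?_⟩
  set B := 1 / 2 + |α2| + |α3| + |c| with hB
  have hc0 := abs_nonneg c
  have h20 := abs_nonneg α2
  have h30 := abs_nonneg α3
  have b1 : -(B * |n|) ≤ (1 / 2) * n := lin_bound _ _ _ (by rw [abs_of_pos (by norm_num)]; linarith)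
  have b2 : -(B * |n|) ≤ α2 * n := lin_bound _ _ _ (by linarith)
  have b3 : -(B * |n|) ≤ α3 * n := lin_bound _ _ _ (by linarith)
  have b4 : -(B * |j|) ≤ c * j := lin_bound _ _ _ (by linarith)
  have hsq : (((M : ℝ) + 1) * j + ν + 1 / 2) ^ 2 / (2 * ((M : ℝ) + 1))
      = (M + 1) * j ^ 2 / 2 + c * j + c ^ 2 / (2 * (M + 1)) := by
    rw [hc]; field_simp; ring
  have hg : 0 ≤ c ^ 2 / (2 * ((M : ℝ) + 1)) := by positivity
  have hMj : j ^ 2 ≤ M * j ^ 2 := by nlinarith [sq_nonneg j]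
  have hMn : n ^ 2 ≤ M * n ^ 2 := by nlinarith [sq_nonneg n]
  have hMd : (j - n) ^ 2 ≤ M * (j - n) ^ 2 := by nlinarith [sq_nonneg (j - n)]
  simp only [Er, hsq]
  refine ⟨?_, ?_, ?_⟩
  · have e : n * (n + 1) / 2 + ((M + 1) * j ^ 2 / 2 + c * j + c ^ 2 / (2 * ((M : ℝ) + 1))) +
      n * (M * j - (M + 1) * j - ν - 1) = n ^ 2 / 2 + (M * j ^ 2 + j ^ 2) / 2 - n * j + α2 * n + c * j
        + c ^ 2 / (2 * (M + 1)) := by rw [h2]; ring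
    rw [e]
    have hq : (n ^ 2 + j ^ 2) / 8 ≤ n ^ 2 / 2 + j ^ 2 - n * j := by
      nlinarith [sq_nonneg (3 * n - 4 * j), sq_nonneg n, sq_nonneg j]
    clear_value B α3 α2 c
    linarith
  · have e : n * (n + 1) / 2 + ((M + 1) * j ^ 2 / 2 + c * j + c ^ 2 / (2 * ((M : ℝ) + 1))) +
      n * (M * (n - ν) - (M + 1) * j - ν - 1) = M * n ^ 2 / 2 + (M * (j - n) ^ 2 + (j - n) ^ 2) / 2
        + α3 * n + c * j + c ^ 2 / (2 * (M + 1)) := by rw [h3]; ring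
    rw [e]
    have hq : (n ^ 2 + j ^ 2) / 8 ≤ n ^ 2 / 2 + (j - n) ^ 2 := by
      nlinarith [sq_nonneg (11 * n - 8 * j), sq_nonneg n, sq_nonneg j]
    clear_value B α3 α2 c
    linarith
  · have e : n * (n + 1) / 2 + ((M + 1) * j ^ 2 / 2 + c * j + c ^ 2 / (2 * ((M : ℝ) + 1))) +
      n * ((M + 1) * j + ν + 1 - (M + 1) * j - ν - 1) = n ^ 2 / 2 + (M * j ^ 2 + j ^ 2) / 2
        + (1 / 2) * n + c * j + c ^ 2 / (2 * (M + 1)) := by ring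
    rw [e]
    clear_value B α3 α2 c
    linarith [sq_nonneg n, sq_nonneg j]

/-- the region on which the triple series lives -/
def Reg (M : ℕ) (ν n j k : ℤ) : Prop :=
  (M * j ≤ k ∧ k ≤ M * (n - ν)) ∨ (M * (n - ν) ≤ k ∧ k ≤ M * j) ∨
  (M * j ≤ k ∧ k ≤ (M + 1) * j + ν + 1) ∨ ((M + 1) * j + ν + 1 ≤ k ∧ k ≤ M * j)

lemma trm_norm (M : ℕ) (ν : ℤ) (τ z : ℂ) (n j k : ℤ) :
    ‖trm M ν τ z n j k‖ = Real.exp (-(2 * Real.pi * (Er M ν n j k * τ.im + k * (z.im / 2)))) := by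
  rw [trm, norm_mul, pm_norm, one_mul, e2_norm]
  congr 4
  have : (((n : ℂ) * (n + 1) / 2 + (((M : ℂ) + 1) * j + ν + 1 / 2) ^ 2 / (2 * ((M : ℂ) + 1)) +
      n * (k - ((M : ℂ) + 1) * j - ν - 1)) * τ + k * (z / 2))
      = ((Er M ν n j k : ℝ) : ℂ) * τ + ((k / 2 : ℝ) : ℂ) * z := by
    simp only [Er]; push_cast; ring
  rw [this, Complex.add_im, Complex.im_ofReal_mul, Complex.im_ofReal_mul]
  ring

lemma abs_btw (a b k L : ℝ) (ha : |a| ≤ L) (hb : |b| ≤ L) (h1 : a ≤ k) (h2 : k ≤ b) : |k| ≤ L := by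
  rw [abs_le] at *
  constructor <;> linarith

lemma trm_bound (M : ℕ) (hM : 0 < M) (ν : ℤ) (τ z : ℂ) (hτ : 0 < τ.im) :
    ∃ K : ℝ, ∀ n j k : ℤ, Reg M ν n j k →
      ‖trm M ν τ z n j k‖ ≤ K * (Real.exp (-|(n : ℝ)|) * (Real.exp (-|(j : ℝ)|) * Real.exp (-|(k : ℝ)|))) := by
  obtain ⟨B, hB⟩ := Er_ends M hM ν
  have hp := Real.pi_pos
  have hM0 : (0 : ℝ) ≤ M := by positivity
  set N : ℝ := M + 1 with hN
  set D : ℝ := M * |(ν : ℝ)| + |(ν : ℝ)| + 1 with hD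
  set C : ℝ := Real.pi * |z.im| + 1 with hC
  have hC0 : 0 < C := by positivity
  set ε : ℝ := 2 * Real.pi * τ.im / 8 with hε
  have hε0 : 0 < ε := by positivity
  set b : ℝ := 2 * Real.pi * τ.im * B + C * N with hb
  refine ⟨Real.exp (C * D + 2 * ((b + 1) ^ 2 / (4 * ε))), fun n j k hk => ?_⟩
  obtain ⟨e1, e2', e3⟩ := hB n j
  set L := ((n : ℝ) ^ 2 + (j : ℝ) ^ 2) / 8 - B * |(n : ℝ)| - B * |(j : ℝ)| with hL
  have hn0 := abs_nonneg (n : ℝ)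
  have hj0 := abs_nonneg (j : ℝ)
  have hν0 := abs_nonneg (ν : ℝ)
  have k1 : |(M : ℝ) * j| ≤ N * |(n : ℝ)| + N * |(j : ℝ)| + D := by
    rw [abs_mul, abs_of_nonneg hM0, hN, hD]; nlinarith [mul_nonneg hM0 hn0, mul_nonneg hM0 hν0]
  have k2 : |(M : ℝ) * (n - ν)| ≤ N * |(n : ℝ)| + N * |(j : ℝ)| + D := by
    rw [abs_mul, abs_of_nonneg hM0, hN, hD]
    have := abs_sub (n : ℝ) ν
    nlinarith [mul_nonneg hM0 hj0, mul_le_mul_of_nonneg_left this hM0]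
  have k3 : |((M : ℝ) + 1) * j + ν + 1| ≤ N * |(n : ℝ)| + N * |(j : ℝ)| + D := by
    have h1 := abs_add_le (((M : ℝ) + 1) * j + ν) 1
    have h2 := abs_add_le (((M : ℝ) + 1) * j) ν
    rw [abs_mul, abs_of_nonneg (by positivity : (0 : ℝ) ≤ (M : ℝ) + 1)] at h2
    rw [abs_one] at h1
    rw [hN, hD]
    nlinarith [mul_nonneg hM0 hn0, mul_nonneg hM0 hν0]
  have hmain : L ≤ Er M ν n j k ∧ |(k : ℝ)| ≤ N * |(n : ℝ)| + N * |(j : ℝ)| + D := by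
    rcases hk with ⟨h1, h2⟩ | ⟨h1, h2⟩ | ⟨h1, h2⟩ | ⟨h1, h2⟩
    · have h1' : (M : ℝ) * j ≤ k := by exact_mod_cast h1
      have h2' : (k : ℝ) ≤ M * (n - ν) := by exact_mod_cast h2
      exact ⟨Er_btw _ _ _ _ _ _ _ _ e1 e2' h1' h2', abs_btw _ _ _ _ k1 k2 h1' h2'⟩
    · have h1' : (M : ℝ) * (n - ν) ≤ k := by exact_mod_cast h1
      have h2' : (k : ℝ) ≤ M * j := by exact_mod_cast h2
      exact ⟨Er_btw _ _ _ _ _ _ _ _ e2' e1 h1' h2', abs_btw _ _ _ _ k2 k1 h1' h2'⟩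
    · have h1' : (M : ℝ) * j ≤ k := by exact_mod_cast h1
      have h2' : (k : ℝ) ≤ (M + 1) * j + ν + 1 := by exact_mod_cast h2
      exact ⟨Er_btw _ _ _ _ _ _ _ _ e1 e3 h1' h2', abs_btw _ _ _ _ k1 k3 h1' h2'⟩
    · have h1' : ((M : ℝ) + 1) * j + ν + 1 ≤ k := by exact_mod_cast h1
      have h2' : (k : ℝ) ≤ M * j := by exact_mod_cast h2
      exact ⟨Er_btw _ _ _ _ _ _ _ _ e3 e1 h1' h2', abs_btw _ _ _ _ k3 k1 h1' h2'⟩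
  obtain ⟨m1, m2⟩ := hmain
  rw [trm_norm, ← Real.exp_add, ← Real.exp_add, ← Real.exp_add]
  apply Real.exp_le_exp.2
  have q1 := quad_bound ε b n hε0
  have q2 := quad_bound ε b j hε0
  have hk1 : -(|z.im| * |(k : ℝ)|) ≤ z.im * k := lin_bound _ _ _ le_rfl
  have hk2 : C * |(k : ℝ)| ≤ C * (N * |(n : ℝ)| + N * |(j : ℝ)| + D) := mul_le_mul_of_nonneg_left m2 hC0.le
  have hk3 : Real.pi * (-(|z.im| * |(k : ℝ)|)) ≤ Real.pi * (z.im * k) := mul_le_mul_of_nonneg_left hk1 hp.le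
  have hk4 : 2 * Real.pi * τ.im * L ≤ 2 * Real.pi * τ.im * Er M ν n j k :=
    mul_le_mul_of_nonneg_left m1 (by positivity)
  have hk5 : 2 * Real.pi * τ.im * L = ε * (n : ℝ) ^ 2 + ε * (j : ℝ) ^ 2
     - 2 * Real.pi * τ.im * B * |(n : ℝ)| - 2 * Real.pi * τ.im * B * |(j : ℝ)| := by
    rw [hL, hε]; ring
  have hk6 : C * |(k : ℝ)| = Real.pi * |z.im| * |(k : ℝ)| + |(k : ℝ)| := by rw [hC]; ring
  have hb1 : b * |(n : ℝ)| = 2 * Real.pi * τ.im * B * |(n : ℝ)| + C * (N * |(n : ℝ)|) := by rw [hb]; ring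
  have hb2 : b * |(j : ℝ)| = 2 * Real.pi * τ.im * B * |(j : ℝ)| + C * (N * |(j : ℝ)|) := by rw [hb]; ring
  clear_value b ε C L D N
  linarith

lemma summable_reg (M : ℕ) (hM : 0 < M) (ν : ℤ) (τ z : ℂ) (hτ : 0 < τ.im) (W : ℤ → ℤ → ℤ → ℂ)
    (hW : ∀ n j k, ‖W n j k‖ ≤ 1) (hR : ∀ n j k, W n j k ≠ 0 → Reg M ν n j k) :
    Summable fun x : ℤ × ℤ × ℤ => W x.1 x.2.1 x.2.2 * trm M ν τ z x.1 x.2.1 x.2.2 := by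
  obtain ⟨K, hK⟩ := trm_bound M hM ν τ z hτ
  have s := summable_exp_neg_abs
  have s2 := s.mul_of_nonneg s (fun _ => (Real.exp_pos _).le) (fun _ => (Real.exp_pos _).le)
  have s3 := s.mul_of_nonneg s2 (fun _ => (Real.exp_pos _).le) (fun _ => by positivity)
  refine Summable.of_norm_bounded (s3.mul_left |K|) fun ⟨n, j, k⟩ => ?_
  by_cases h : W n j k = 0
  · simp only [h, zero_mul, norm_zero]; positivity
  · rw [norm_mul]
    calc _ ≤ 1 * ‖trm M ν τ z n j k‖ := by gcongr; exact hW n j k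
      _ ≤ _ := by
        rw [one_mul]
        refine (hK n j k (hR n j k h)).trans ?_
        dsimp only
        gcongr
        exact le_abs_self K

end Part4

section Part5
open Filter Topology

lemma pm_congr (a b : ℤ) (h : Even (a - b)) : (-1 : ℂ) ^ a = (-1) ^ b := by
  have : a = b + (a - b) := by ring
  rw [this, zpow_add₀ (by norm_num), h.neg_one_zpow, mul_one]

/-- Heaviside weight -/
def Hv (a b : ℤ) : ℂ := if a < b then 1 else 0

lemma Hv_succ (k b : ℤ) : Hv k (b + 1) = Hv k b + if k = b then 1 else 0 := by
  simp only [Hv]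
  split_ifs <;> first | omega | simp

lemma geo (x : ℂ) (hx : x ≠ 0) (hx1 : 1 - x ≠ 0) (a b : ℤ) :
    HasSum (fun k : ℤ => (Hv k b - Hv k a) * x ^ k) ((x ^ a - x ^ b) / (1 - x)) := by
  have hs : ∀ b : ℤ, HasSum (fun k : ℤ => (if k = b then (1 : ℂ) else 0) * x ^ k) (x ^ b) := by
    intro b
    have := hasSum_ite_eq b (x ^ b)
    refine this.congr_fun ?_ |> fun h => h
    intro k
    by_cases h : k = b <;> simp [h]
  induction b using Int.inductionOn' (b := a) with
  | zero => simpa using hasSum_zero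
  | succ b _ ih =>
    have h := ih.add (hs b)
    have e : (x ^ a - x ^ b) / (1 - x) + x ^ b = (x ^ a - x ^ (b + 1)) / (1 - x) := by
      rw [zpow_add_one₀ hx]; field_simp; ring
    rw [e] at h
    refine h.congr_fun ?_
    intro k
    rw [Hv_succ]; ring
  | pred b _ ih =>
    have h := ih.sub (hs (b - 1))
    have e : (x ^ a - x ^ b) / (1 - x) - x ^ (b - 1) = (x ^ a - x ^ (b - 1)) / (1 - x) := by
      have : x ^ b = x ^ (b - 1) * x := by rw [← zpow_add_one₀ hx]; congr 1; ring
      rw [this]; field_simp; ring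
    rw [e] at h
    refine h.congr_fun ?_
    intro k
    have := Hv_succ k (b - 1)
    rw [sub_add_cancel] at this
    rw [this]; ring

lemma theta_vanish (τ : ℂ) (d : ℤ) :
    ∑' n : ℤ, (-1 : ℂ) ^ n * e2 (((n : ℂ) * (n + 1) / 2 + n * d) * τ) = 0 := by
  have h := (Equiv.subLeft (-1 - 2 * d)).tsum_eq
    (fun n : ℤ => (-1 : ℂ) ^ n * e2 (((n : ℂ) * (n + 1) / 2 + n * d) * τ))
  have h2 : ∀ n : ℤ, (-1 : ℂ) ^ (Equiv.subLeft (-1 - 2 * d) n) *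
      e2 ((((Equiv.subLeft (-1 - 2 * d) n : ℤ) : ℂ) * ((Equiv.subLeft (-1 - 2 * d) n : ℤ) + 1) / 2 +
        (Equiv.subLeft (-1 - 2 * d) n : ℤ) * d) * τ) =
      -((-1 : ℂ) ^ n * e2 (((n : ℂ) * (n + 1) / 2 + n * d) * τ)) := by
    intro n
    simp only [Equiv.subLeft_apply]
    have s1 : (-1 : ℂ) ^ (-1 - 2 * d - n) = -(-1) ^ n := by
      rw [pm_congr (-1 - 2 * d - n) (n + 1) ⟨-1 - d - n, by ring⟩, zpow_add_one₀ (by norm_num)]; ring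
    rw [s1, neg_mul]
    congr 3
    push_cast; ring
  simp_rw [h2] at h
  rw [tsum_neg] at h
  exact self_eq_neg.1 h.symm

section main
variable (M : ℕ) (ν : ℤ) (τ z : ℂ)

/-- upper exponent -/
def aa (j : ℤ) : ℤ := (M + 1) * j + ν + 1
/-- first weight -/
def w1 (n j k : ℤ) : ℂ := Hv k (M * (n - ν)) - Hv k (M * j)
/-- second weight -/
def w2 (_n j k : ℤ) : ℂ := Hv k (aa M ν j) - Hv k (M * j)

lemma Hv_sub_norm (k a b : ℤ) : ‖Hv k a - Hv k b‖ ≤ 1 := by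
  simp only [Hv]; split_ifs <;> simp

lemma Hv_sub_ne (k a b : ℤ) (h : Hv k a - Hv k b ≠ 0) : (b ≤ k ∧ k ≤ a) ∨ (a ≤ k ∧ k ≤ b) := by
  by_contra hc
  apply h
  simp only [Hv]
  split_ifs <;> first | omega | simp

lemma sum_w1 (hM : 0 < M) (hτ : 0 < τ.im) :
    Summable fun x : ℤ × ℤ × ℤ => w1 M ν x.1 x.2.1 x.2.2 * trm M ν τ z x.1 x.2.1 x.2.2 := by
  apply summable_reg M hM ν τ z hτ
  · intro n j k; exact Hv_sub_norm _ _ _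
  · intro n j k h
    rcases Hv_sub_ne _ _ _ h with h | h
    · exact Or.inl h
    · exact Or.inr (Or.inl h)

lemma sum_w2 (hM : 0 < M) (hτ : 0 < τ.im) :
    Summable fun x : ℤ × ℤ × ℤ => w2 M ν x.1 x.2.1 x.2.2 * trm M ν τ z x.1 x.2.1 x.2.2 := by
  apply summable_reg M hM ν τ z hτ
  · intro n j k; exact Hv_sub_norm _ _ _
  · intro n j k h
    rcases Hv_sub_ne _ _ _ h with h | h
    · exact Or.inr (Or.inr (Or.inl h))
    · exact Or.inr (Or.inr (Or.inr h))

lemma trm_eq (n j k : ℤ) : trm M ν τ z n j k =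
    ((-1 : ℂ) ^ n * e2 (((n : ℂ) * (n + 1) / 2 + n * ((k - aa M ν j : ℤ) : ℂ)) * τ)) *
    ((-1 : ℂ) ^ j * e2 ((((M : ℂ) + 1) * j + ν + 1 / 2) ^ 2 / (2 * ((M : ℂ) + 1)) * τ + k * (z / 2))) := by
  rw [trm, zpow_add₀ (by norm_num), mul_mul_mul_comm, ← e2_add]
  congr 2
  simp only [aa]; push_cast; ring

lemma tsum_w2 (hM : 0 < M) (hτ : 0 < τ.im) :
    ∑' x : ℤ × ℤ × ℤ, w2 M ν x.1 x.2.1 x.2.2 * trm M ν τ z x.1 x.2.1 x.2.2 = 0 := by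
  have s := sum_w2 M ν τ z hM hτ
  have hc := Summable.tsum_comm (f := fun (n : ℤ) (y : ℤ × ℤ) =>
    w2 M ν n y.1 y.2 * trm M ν τ z n y.1 y.2) s
  have hv : ∀ y : ℤ × ℤ, ∑' n : ℤ, w2 M ν n y.1 y.2 * trm M ν τ z n y.1 y.2 = 0 := by
    rintro ⟨j, k⟩
    have h1 : ∀ n : ℤ, w2 M ν n j k * trm M ν τ z n j k = (w2 M ν 0 j k) *
      (((-1 : ℂ) ^ n * e2 (((n : ℂ) * (n + 1) / 2 + n * ((k - aa M ν j : ℤ) : ℂ)) * τ)) *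
    ((-1 : ℂ) ^ j * e2 ((((M : ℂ) + 1) * j + ν + 1 / 2) ^ 2 / (2 * ((M : ℂ) + 1)) * τ + k * (z / 2)))) := by
      intro n
      rw [← trm_eq]; rfl
    rw [tsum_congr h1, tsum_mul_left, tsum_mul_right, theta_vanish]; simp
  have hz : ∑' y : ℤ × ℤ, ∑' n : ℤ, w2 M ν n y.1 y.2 * trm M ν τ z n y.1 y.2 = 0 := by
    rw [tsum_congr hv, tsum_zero]
  have hp := Summable.tsum_prod (f := fun x : ℤ × ℤ × ℤ => w2 M ν x.1 x.2.1 x.2.2 * trm M ν τ z x.1 x.2.1 x.2.2) s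
  exact hp.trans (hc.symm.trans hz)

lemma trm_geo (hw : ∀ n : ℤ, 1 - e2 (z / 2 + n * τ) ≠ 0) (n j : ℤ) :
    HasSum (fun k : ℤ => (w1 M ν n j k - w2 M ν n j k) * trm M ν τ z n j k)
      (trm M ν τ z n j (aa M ν j) / (1 - e2 (z / 2 + n * τ)) -
        trm M ν τ z n j (M * (n - ν)) / (1 - e2 (z / 2 + n * τ))) := by
  have h := (geo (e2 (z / 2 + n * τ)) (e2_ne _) (hw n) (aa M ν j) (M * (n - ν))).mul_left
    (trm M ν τ z n j 0)
  have h2 : ∀ k : ℤ, trm M ν τ z n j k = trm M ν τ z n j 0 * e2 (z / 2 + n * τ) ^ k := by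
    intro k
    rw [trm, trm, e2_zpow, mul_assoc, ← e2_add]
    congr 2; push_cast; ring
  rw [h2 (aa M ν j), h2 (M * (n - ν))]
  have e : trm M ν τ z n j 0 * ((e2 (z / 2 + n * τ) ^ aa M ν j - e2 (z / 2 + n * τ) ^ ((M : ℤ) * (n - ν))) /
      (1 - e2 (z / 2 + n * τ))) = trm M ν τ z n j 0 * e2 (z / 2 + n * τ) ^ aa M ν j / (1 - e2 (z / 2 + n * τ)) -
      trm M ν τ z n j 0 * e2 (z / 2 + n * τ) ^ ((M : ℤ) * (n - ν)) / (1 - e2 (z / 2 + n * τ)) := by ring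
  rw [← e]
  refine h.congr_fun ?_
  intro k
  rw [h2 k]; simp only [w1, w2]; ring

end main

end Part5

section Part6
open Filter Topology

section main2
variable (M : ℕ) (ν : ℤ) (τ z : ℂ)

/-- the summand of the indefinite sum -/
def fI (r : ℕ) (j p : ℤ) : ℂ :=
  (-1 : ℂ) ^ j *
            e2 ((((M : ℂ) / 2 + 1 / 2) * ((j : ℂ) + (ν : ℂ) - ((ν : ℂ) + 1 / 2) / (2 * ((M : ℂ) / 2) + 1)) ^ 2 -
              ((M : ℂ) / 2) * ((p : ℂ) + (ν : ℂ) - (r : ℂ) / (2 * ((M : ℂ) / 2))) ^ 2) * τ)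

/-- the summand of the theta function -/
def tI (r : ℕ) (l : ℤ) : ℂ :=
  (1 : ℂ) ^ l *
    e2 (((M : ℂ) / 2) * ((l : ℂ) + (r : ℂ) / (2 * ((M : ℂ) / 2))) ^ 2 * τ +
      ((M : ℂ) / 2) * ((l : ℂ) + (r : ℂ) / (2 * ((M : ℂ) / 2))) * z)

lemma trm_sub (hM : 0 < M) (r : ℕ) (l J P : ℤ) :
    trm M ν τ z (P + ν + l) (P + l - J) (l * M + r) =
      (-1 : ℂ) ^ ν * fI M ν τ r J P * tI M τ z r l := by
  have hM0 : (M : ℂ) ≠ 0 := by exact_mod_cast hM.ne'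
  have hM1 : (M : ℂ) + 1 ≠ 0 := by exact_mod_cast (Nat.succ_ne_zero M)
  rw [trm, fI, tI, one_zpow, one_mul, pm_congr (P + ν + l + (P + l - J)) (ν + J) ⟨P + l - J, by ring⟩,
    zpow_add₀ (by norm_num)]
  rw [mul_assoc, mul_assoc, mul_assoc, ← e2_add]
  congr 3
  push_cast
  field_simp
  ring

lemma w1_sub (hM : 0 < M) (r : ℕ) (hr : r < M) (l J P : ℤ) :
    w1 M ν (P + ν + l) (P + l - J) (l * M + r) = Hv 0 P - Hv J P := by
  have key : ∀ X : ℤ, (l * M + r < M * (X + l)) ↔ 0 < X := by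
    intro X
    have hr' : (r : ℤ) < M := by exact_mod_cast hr
    have hr0 : (0 : ℤ) ≤ r := by positivity
    constructor
    · intro h
      by_contra hc
      have hc : X ≤ 0 := by omega
      nlinarith [mul_nonneg (show (0 : ℤ) ≤ M by positivity) (sub_nonneg.2 hc)]
    · intro h
      nlinarith [mul_nonneg (show (0 : ℤ) ≤ M by positivity) (show 0 ≤ X - 1 by omega)]
  have e1 : Hv (l * M + r) (M * (P + ν + l - ν)) = Hv 0 P := by
    simp only [Hv]
    rw [show P + ν + l - ν = P + l by ring]
    simp only [key]
  have e2' : Hv (l * M + r) (M * (P + l - J)) = Hv J P := by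
    simp only [Hv]
    rw [show P + l - J = (P - J) + l by ring]
    simp only [key, sub_pos]
  rw [w1, e1, e2']

lemma indef_term (f : ℤ → ℤ → ℂ) :
    indefSum f = ∑' jp : ℤ × ℤ, (Hv 0 jp.2 - Hv jp.1 jp.2) * f jp.1 jp.2 := by
  rw [indefSum]
  refine tsum_congr fun jp => ?_
  simp only [Hv]
  split_ifs <;> first | omega | simp

/-- change of variables -/
def EE [NeZero M] : (Fin M × ℤ) × (ℤ × ℤ) ≃ ℤ × ℤ × ℤ where
  toFun y := (y.2.2 + ν + y.1.2, y.2.2 + y.1.2 - y.2.1, y.1.2 * M + y.1.1)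
  invFun x := ((((Int.divModEquiv M) x.2.2).2, ((Int.divModEquiv M) x.2.2).1),
    (x.1 - ν - x.2.1, x.1 - ν - ((Int.divModEquiv M) x.2.2).1))
  left_inv := by
    rintro ⟨⟨r, l⟩, J, P⟩
    have h : (Int.divModEquiv M) (l * M + r) = (l, r) := by
      have := (Int.divModEquiv M).apply_symm_apply (l, r)
      rwa [Int.divModEquiv_symm_apply] at this
    simp only [h]
    ext <;> simp <;> ring
  right_inv := by
    rintro ⟨n, j, k⟩
    have h := (Int.divModEquiv M).symm_apply_apply k
    rw [Int.divModEquiv_symm_apply] at h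
    simp only [h]
    ext <;> simp <;> ring

lemma tsum_w1 (hM : 0 < M) (hτ : 0 < τ.im) :
    ∑' x : ℤ × ℤ × ℤ, w1 M ν x.1 x.2.1 x.2.2 * trm M ν τ z x.1 x.2.1 x.2.2 =
    (-1 : ℂ) ^ ν * ∑ r ∈ Finset.range M, indefSum (fI M ν τ r) * jtheta 1 (r : ℂ) ((M : ℂ) / 2) τ z := by
  have : NeZero M := ⟨hM.ne'⟩
  have s := sum_w1 M ν τ z hM hτ
  have hE : ∀ y : (Fin M × ℤ) × (ℤ × ℤ),
      (fun x : ℤ × ℤ × ℤ => w1 M ν x.1 x.2.1 x.2.2 * trm M ν τ z x.1 x.2.1 x.2.2) (EE M ν y) =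
      ((-1 : ℂ) ^ ν * tI M τ z y.1.1 y.1.2) * ((Hv 0 y.2.2 - Hv y.2.1 y.2.2) * fI M ν τ y.1.1 y.2.1 y.2.2) := by
    rintro ⟨⟨r, l⟩, J, P⟩
    have h1 := w1_sub M ν hM r r.2 l J P
    have h2 := trm_sub M ν τ z hM r l J P
    simp only [EE, Equiv.coe_fn_mk]
    rw [h1, h2]; ring
  have s' := (EE M ν).summable_iff.2 s
  have s'' : Summable fun y : (Fin M × ℤ) × (ℤ × ℤ) =>
      ((-1 : ℂ) ^ ν * tI M τ z y.1.1 y.1.2) * ((Hv 0 y.2.2 - Hv y.2.1 y.2.2) * fI M ν τ y.1.1 y.2.1 y.2.2) :=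
    s'.congr hE
  have t1 := (EE M ν).tsum_eq (fun x : ℤ × ℤ × ℤ => w1 M ν x.1 x.2.1 x.2.2 * trm M ν τ z x.1 x.2.1 x.2.2)
  rw [← t1, tsum_congr hE, s''.tsum_prod]
  have h3 : ∀ y : Fin M × ℤ, ∑' x : ℤ × ℤ, ((-1 : ℂ) ^ ν * tI M τ z y.1 y.2) *
      ((Hv 0 x.2 - Hv x.1 x.2) * fI M ν τ y.1 x.1 x.2) =
      ((-1 : ℂ) ^ ν * tI M τ z y.1 y.2) * indefSum (fI M ν τ y.1) := by
    intro y
    rw [tsum_mul_left, ← indef_term]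
  have s3 := s''.prod
  simp only [h3] at s3 ⊢
  rw [s3.tsum_prod, tsum_fintype, Finset.mul_sum, ← Fin.sum_univ_eq_sum_range
    (fun r => (-1 : ℂ) ^ ν * (indefSum (fI M ν τ r) * jtheta 1 (r : ℂ) ((M : ℂ) / 2) τ z))]
  refine Finset.sum_congr rfl fun r _ => ?_
  dsimp only
  rw [tsum_mul_right, tsum_mul_left, show jtheta 1 ((r : ℕ) : ℂ) ((M : ℂ) / 2) τ z = ∑' l, tI M τ z r l from rfl]
  ring

end main2

end Part6

section Part7
open Filter Topology

section main3
variable (M : ℕ) (ν : ℤ) (τ z : ℂ)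

/-- summand of the theta function of index m + 1/2 -/
def th (u : ℂ) (j : ℤ) : ℂ := (-1 : ℂ) ^ j *
    e2 (((M : ℂ) / 2 + 1 / 2) * ((j : ℂ) + ((ν : ℂ) + 1 / 2) / (2 * ((M : ℂ) / 2 + 1 / 2))) ^ 2 * τ +
      ((M : ℂ) / 2 + 1 / 2) * ((j : ℂ) + ((ν : ℂ) + 1 / 2) / (2 * ((M : ℂ) / 2 + 1 / 2))) * u)

/-- summand of the Appell function -/
def ph (j : ℤ) : ℂ := (1 : ℂ) ^ j *
    e2 ((M : ℂ) / 2 * (j : ℂ) * ((z / 2 + (ν : ℂ) * τ) + (z / 2 - (ν : ℂ) * τ)) + 0 * (z / 2 + (ν : ℂ) * τ) +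
      ((M : ℂ) / 2 * (j : ℂ) ^ 2 + 0 * (j : ℂ)) * τ) /
      (1 - e2 ((z / 2 + (ν : ℂ) * τ) + (j : ℂ) * τ))

/-- summand of the Lerch sum -/
def lt (n : ℤ) : ℂ := (-1 : ℂ) ^ n * e2 ((n : ℂ) * (n + 1) / 2 * τ) / (1 - e2 (z / 2 + n * τ))

lemma th_summable (hτ : 0 < τ.im) (u : ℂ) : Summable (th M ν τ u) := by
  apply Summable.of_norm
  have hA : 0 < ((((M : ℝ) / 2 + 1 / 2 : ℝ) : ℂ) * τ).im := by
    rw [Complex.im_ofReal_mul]; positivity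
  set c : ℂ := ((ν : ℂ) + 1 / 2) / (2 * ((M : ℂ) / 2 + 1 / 2)) with hc
  have h := gauss_summable ((((M : ℝ) / 2 + 1 / 2 : ℝ) : ℂ) * τ)
    ((((M : ℂ) / 2 + 1 / 2)) * (2 * c * τ + u)) ((((M : ℂ) / 2 + 1 / 2)) * (c ^ 2 * τ + c * u)) hA
  refine h.congr fun j => ?_
  rw [th, norm_mul, pm_norm, one_mul]
  congr 2
  push_cast; ring

lemma ph_summable (hM : 0 < M) (hτ : 0 < τ.im) : Summable (ph M ν τ z) := by
  obtain ⟨c, hc⟩ := den_bound τ hτ (z / 2 + ν * τ)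
  have hA : 0 < ((((M : ℝ) / 2 : ℝ) : ℂ) * τ).im := by
    rw [Complex.im_ofReal_mul]; positivity
  have h := gauss_summable ((((M : ℝ) / 2 : ℝ) : ℂ) * τ) ((M : ℂ) / 2 * z) 0 hA
  refine Summable.of_norm_bounded (h.mul_right c) fun j => ?_
  rw [ph, one_zpow, one_mul, div_eq_mul_inv, norm_mul]
  refine mul_le_mul (le_of_eq ?_) (hc j) (norm_nonneg _) (norm_nonneg _)
  congr 2
  push_cast; ring

lemma trm_a (n j : ℤ) : trm M ν τ z n j (aa M ν j) / (1 - e2 (z / 2 + n * τ)) =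
    (e2 (z / 4) * lt τ z n) * th M ν τ z j := by
  have hM1 : (M : ℂ) + 1 ≠ 0 := by exact_mod_cast (Nat.succ_ne_zero M)
  have h : trm M ν τ z n j (aa M ν j) = (e2 (z / 4) * ((-1 : ℂ) ^ n * e2 ((n : ℂ) * (n + 1) / 2 * τ))) *
     th M ν τ z j := by
    rw [trm, th, zpow_add₀ (by norm_num)]
    have : ∀ a b c d e : ℂ, a * (b * c) * (d * e) = b * d * (a * c * e) := by intros; ring
    rw [this, ← e2_add, ← e2_add]
    congr 2
    simp only [aa]; push_cast
    rw [show (M : ℂ) / 2 + 1 / 2 = (M + 1) / 2 by ring]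
    field_simp
    ring
  rw [h, lt]; ring

lemma trm_b (n j : ℤ) : trm M ν τ z n j (M * (n - ν)) / (1 - e2 (z / 2 + n * τ)) =
    (e2 (-((M : ℂ) / 2 * (ν : ℂ) ^ 2) * τ) * ph M ν τ z (n - ν)) * th M ν τ 0 (j - n) := by
  have hM1 : (M : ℂ) + 1 ≠ 0 := by exact_mod_cast (Nat.succ_ne_zero M)
  have hd : e2 (z / 2 + n * τ) = e2 ((z / 2 + (ν : ℂ) * τ) + ((n - ν : ℤ) : ℂ) * τ) := by
    congr 1; push_cast; ring
  rw [ph, ← hd, one_zpow, one_mul, mul_div_assoc', div_mul_eq_mul_div]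
  congr 1
  rw [trm, th, pm_congr (n + j) (j - n) ⟨n, by ring⟩, mul_left_comm, ← e2_add, ← e2_add]
  congr 2
  push_cast
  rw [show (M : ℂ) / 2 + 1 / 2 = (M + 1) / 2 by ring]
  field_simp
  ring

set_option maxHeartbeats 2000000 in
lemma key (hM : 0 < M) (hτ : 0 < τ.im) (hw : ∀ n : ℤ, 1 - e2 (z / 2 + n * τ) ≠ 0) :
    e2 (z / 4) * (∑' n, lt τ z n) * (∑' j, th M ν τ z j) =
    e2 (-((M : ℂ) / 2 * (ν : ℂ) ^ 2) * τ) * (∑' n, ph M ν τ z n) * (∑' j, th M ν τ 0 j) +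
    ∑' x : ℤ × ℤ × ℤ, w1 M ν x.1 x.2.1 x.2.2 * trm M ν τ z x.1 x.2.1 x.2.2 := by
  have s1 := sum_w1 M ν τ z hM hτ
  have s2 := sum_w2 M ν τ z hM hτ
  have s3 : Summable fun x : ℤ × ℤ × ℤ =>
      (w1 M ν x.1 x.2.1 x.2.2 - w2 M ν x.1 x.2.1 x.2.2) * trm M ν τ z x.1 x.2.1 x.2.2 :=
    (s1.sub s2).congr fun x => by ring
  have e3 : ∑' x : ℤ × ℤ × ℤ,
      (w1 M ν x.1 x.2.1 x.2.2 - w2 M ν x.1 x.2.1 x.2.2) * trm M ν τ z x.1 x.2.1 x.2.2 =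
      ∑' x : ℤ × ℤ × ℤ, w1 M ν x.1 x.2.1 x.2.2 * trm M ν τ z x.1 x.2.1 x.2.2 := by
    have h := s1.tsum_sub s2
    rw [tsum_w2 M ν τ z hM hτ, sub_zero] at h
    rw [← h]
    exact tsum_congr fun x => by ring
  rw [← e3]
  have p1 : ∀ n : ℤ, ∑' y : ℤ × ℤ, (w1 M ν n y.1 y.2 - w2 M ν n y.1 y.2) * trm M ν τ z n y.1 y.2 =
      (e2 (z / 4) * lt τ z n) * (∑' j, th M ν τ z j) -
      (e2 (-((M : ℂ) / 2 * (ν : ℂ) ^ 2) * τ) * ph M ν τ z (n - ν)) * (∑' j, th M ν τ 0 j) := by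
    intro n
    have sn : Summable fun y : ℤ × ℤ => (w1 M ν n y.1 y.2 - w2 M ν n y.1 y.2) * trm M ν τ z n y.1 y.2 :=
      s3.prod_factor n
    rw [sn.tsum_prod]
    have hj : ∀ j : ℤ, ∑' k : ℤ, (w1 M ν n j k - w2 M ν n j k) * trm M ν τ z n j k =
        (e2 (z / 4) * lt τ z n) * th M ν τ z j -
        (e2 (-((M : ℂ) / 2 * (ν : ℂ) ^ 2) * τ) * ph M ν τ z (n - ν)) * th M ν τ 0 (j - n) := by
      intro j
      rw [(trm_geo M ν τ z hw n j).tsum_eq, trm_a, trm_b]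
    rw [tsum_congr hj]
    have t2 : Summable fun j : ℤ => th M ν τ 0 (j - n) :=
      (Equiv.subRight n).summable_iff.2 (th_summable M ν τ hτ 0)
    have t3 : ∑' j : ℤ, th M ν τ 0 (j - n) = ∑' j, th M ν τ 0 j :=
      (Equiv.subRight n).tsum_eq (th M ν τ 0)
    rw [((th_summable M ν τ hτ z).mul_left _).tsum_sub (t2.mul_left _), tsum_mul_left, tsum_mul_left, t3]
  have u1 : ∑' x : ℤ × ℤ × ℤ,
      (w1 M ν x.1 x.2.1 x.2.2 - w2 M ν x.1 x.2.1 x.2.2) * trm M ν τ z x.1 x.2.1 x.2.2 =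
      ∑' n : ℤ, ((e2 (z / 4) * lt τ z n) * (∑' j, th M ν τ z j) -
      (e2 (-((M : ℂ) / 2 * (ν : ℂ) ^ 2) * τ) * ph M ν τ z (n - ν)) * (∑' j, th M ν τ 0 j)) := by
    rw [s3.tsum_prod]
    exact tsum_congr p1
  have u2 : Summable fun n : ℤ => ((e2 (z / 4) * lt τ z n) * (∑' j, th M ν τ z j) -
      (e2 (-((M : ℂ) / 2 * (ν : ℂ) ^ 2) * τ) * ph M ν τ z (n - ν)) * (∑' j, th M ν τ 0 j)) :=
    s3.prod.congr p1
  have v2 : Summable fun n : ℤ => ph M ν τ z (n - ν) :=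
    (Equiv.subRight ν).summable_iff.2 (ph_summable M ν τ z hM hτ)
  have v3 : ∑' n : ℤ, ph M ν τ z (n - ν) = ∑' n, ph M ν τ z n :=
    (Equiv.subRight ν).tsum_eq (ph M ν τ z)
  have v4 := (v2.mul_left (e2 (-((M : ℂ) / 2 * (ν : ℂ) ^ 2) * τ))).mul_right (∑' j, th M ν τ 0 j)
  have v5 := v4.tsum_add u2
  rw [tsum_mul_right, tsum_mul_left, v3] at v5
  have v6 : e2 (z / 4) * (∑' n, lt τ z n) * (∑' j, th M ν τ z j) =
      ∑' n, e2 (z / 4) * lt τ z n * (∑' j, th M ν τ z j) := by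
    rw [tsum_mul_right, tsum_mul_left]
  rw [u1, ← v5, v6]
  exact tsum_congr fun n => by ring

lemma half_theta : jtheta (-1) (1 / 2) (1 / 2) τ z = e2 (τ / 8 + z / 4) *
    ∑' j : ℤ, (-1 : ℂ) ^ j * e2 ((j : ℂ) * (j + 1) / 2 * τ + j * (z / 2)) := by
  rw [jtheta, ← tsum_mul_left]
  refine tsum_congr fun j => ?_
  rw [mul_left_comm, ← e2_add]
  congr 2
  ring

end main3


end Part7

theorem stmt_7 (M : ℕ) (hM : 0 < M) (m : ℂ) (hm : m = (M : ℂ) / 2)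
    (ν : ℤ) (hν : 0 ≤ ν ∧ ν ≤ (M : ℤ))
    (τ : ℂ) (hτ : 0 < τ.im) (z : ℂ)
    (hz : ∀ a b : ℤ, m * z ≠ (a : ℂ) + (b : ℂ) * τ) :
    (-1 : ℂ) ^ ν * e2 (-(m * (ν : ℂ) ^ 2) * τ) *
        jtheta (-1) ((ν : ℂ) + 1 / 2) (m + 1 / 2) τ 0 *
        Phi1 1 m 0 τ (z / 2 + (ν : ℂ) * τ) (z / 2 - (ν : ℂ) * τ) +
      ∑ r ∈ Finset.range M,
        (indefSum fun j p =>
          (-1 : ℂ) ^ j *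
            e2 (((m + 1 / 2) * ((j : ℂ) + (ν : ℂ) - ((ν : ℂ) + 1 / 2) / (2 * m + 1)) ^ 2 -
              m * ((p : ℂ) + (ν : ℂ) - (r : ℂ) / (2 * m)) ^ 2) * τ)) *
          jtheta 1 (r : ℂ) m τ z =
      -(-1 : ℂ) ^ ν * dedekindEta τ ^ 3 *
        jtheta (-1) ((ν : ℂ) + 1 / 2) (m + 1 / 2) τ z / jtheta (-1) (1 / 2) (1 / 2) τ z := by

  subst hm
  have hw : ∀ n : ℤ, 1 - e2 (z / 2 + n * τ) ≠ 0 := by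
    intro n h
    obtain ⟨a, ha⟩ := e2_eq_one (sub_eq_zero.1 h).symm
    apply hz (M * a) (-(M * n))
    push_cast
    linear_combination (M : ℂ) * ha
  have hk := key M ν τ z hM hτ hw
  rw [tsum_w1 M ν τ z hM hτ] at hk
  have hTL := TL τ hτ (z / 2) hw
  have hE := qp_inf_ne τ hτ
  rw [half_theta, dedekindEta]
  have f1 : jtheta (-1) ((ν : ℂ) + 1 / 2) ((M : ℂ) / 2 + 1 / 2) τ 0 = ∑' j, th M ν τ 0 j := rfl
  have f2 : jtheta (-1) ((ν : ℂ) + 1 / 2) ((M : ℂ) / 2 + 1 / 2) τ z = ∑' j, th M ν τ z j := rfl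
  have f3 : Phi1 1 ((M : ℂ) / 2) 0 τ (z / 2 + (ν : ℂ) * τ) (z / 2 - (ν : ℂ) * τ) = ∑' j, ph M ν τ z j := rfl
  have f4 : (∑' j : ℤ, (-1 : ℂ) ^ j * e2 ((j : ℂ) * (j + 1) / 2 * τ) / (1 - e2 (z / 2 + j * τ))) =
    ∑' n, lt τ z n := rfl
  rw [f1, f2, f3]
  rw [f4] at hTL
  have f5 : ∑ r ∈ Finset.range M,
        (indefSum fun j p =>
          (-1 : ℂ) ^ j *
            e2 ((((M : ℂ) / 2) + 1 / 2) * ((j : ℂ) + (ν : ℂ) - ((ν : ℂ) + 1 / 2) / (2 * ((M : ℂ) / 2) + 1)) ^ 2 * τ -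
              ((M : ℂ) / 2) * ((p : ℂ) + (ν : ℂ) - (r : ℂ) / (2 * ((M : ℂ) / 2))) ^ 2 * τ)) *
          jtheta 1 (r : ℂ) ((M : ℂ) / 2) τ z =
     ∑ r ∈ Finset.range M, indefSum (fI M ν τ r) * jtheta 1 (r : ℂ) ((M : ℂ) / 2) τ z := by
    simp only [← sub_mul]
    rfl
  simp only [← sub_mul] at f5
  rw [f5]
  set S := ∑ r ∈ Finset.range M, indefSum (fI M ν τ r) * jtheta 1 (r : ℂ) ((M : ℂ) / 2) τ z
  set T := ∑' j : ℤ, (-1 : ℂ) ^ j * e2 ((j : ℂ) * (j + 1) / 2 * τ + j * (z / 2))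
  set E := ∏' k : ℕ, (1 - e2 (((k : ℂ) + 1) * τ))
  set X := ∑' n, lt τ z n
  set A := ∑' j, th M ν τ z j
  set B := ∑' j, th M ν τ 0 j
  set P := ∑' n, ph M ν τ z n
  have hT : T ≠ 0 := by
    intro h
    rw [h, zero_mul] at hTL
    have := mul_ne_zero (neg_ne_zero.2 (e2_ne (-(z / 2)))) (pow_ne_zero 3 hE)
    exact this hTL.symm
  have hs : (-1 : ℂ) ^ ν * (-1 : ℂ) ^ ν = 1 := by
    rw [← zpow_add₀ (by norm_num), Even.neg_one_zpow ⟨ν, rfl⟩]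
  have hE3 : E ^ 3 = -(e2 (z / 4) * e2 (z / 4)) * (T * X) := by
    rw [hTL, ← e2_add]
    have : e2 (z / 4 + z / 4) * e2 (-(z / 2)) = 1 := by
      rw [← e2_add, show z / 4 + z / 4 + -(z / 2) = 0 by ring, e2_zero]
    linear_combination (-E ^ 3) * this
  have h8 : e2 (τ / 24) ^ 3 = e2 (τ / 8) := by
    rw [e2_pow]; congr 1; push_cast; ring
  rw [mul_pow, h8, hE3, e2_add, eq_div_iff (mul_ne_zero (mul_ne_zero (e2_ne _) (e2_ne _)) hT)]
  linear_combination (-(-1 : ℂ) ^ ν * (e2 (τ / 8) * e2 (z / 4) * T)) * hk -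
    (e2 (τ / 8) * e2 (z / 4) * T * S) * hs
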